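/- There is no pair of orthogonal latin squares of order 6; that is, there do not exist functions L, M : Fin 6 × Fin 6 → Fin 6, each a latin square, such that the map (i,j) ↦ (L(i,j), M(i,j)) is injective (Tarry's resolution of Euler's conjecture for order 6). -/

import Mathlib

open scoped BigOperators Classical

noncomputable section

namespace AMEPaper

/-- Combine a configuration on the complement of `B` with a configuration on `B`
into a full configuration on `Fin n`. -/
def combine {n d : ℕ} (B : Finset (Fin n)) (a : {i : Fin n // i ∉ B} → Fin d)
    (b : {i : Fin n // i ∈ B} → Fin d) : Fin n → Fin d :=
  fun i => if h : i ∈ B then b ⟨i, h⟩ else a ⟨i, h⟩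

/-- `ψ` is an absolutely maximally entangled state with `n` sites and local dimension `d`:
it is a unit vector and, for every set `B` of at most `n/2` sites, the reduced density
matrix on `B` equals `d ^ (-|B|)` times the identity. -/
def IsAME (n d : ℕ) (ψ : (Fin n → Fin d) → ℂ) : Prop :=
  (∑ s : Fin n → Fin d, ‖ψ s‖ ^ 2 = 1) ∧
  ∀ B : Finset (Fin n), B.card ≤ n / 2 →
    ∀ b b' : {i : Fin n // i ∈ B} → Fin d,
      (∑ a : {i : Fin n // i ∉ B} → Fin d,
          ψ (combine B a b) * (starRingEnd ℂ) (ψ (combine B a b'))) =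
        if b = b' then ((d : ℂ) ^ B.card)⁻¹ else 0

/-- `ψ` has minimal support: its support in the computational basis has exactly
`d ^ ⌊n/2⌋` elements. -/
def HasMinimalSupport (n d : ℕ) (ψ : (Fin n → Fin d) → ℂ) : Prop :=
  {s : Fin n → Fin d | ψ s ≠ 0}.ncard = d ^ (n / 2)

/-- `C` is an MDS code over the alphabet `Fin d` with wordlength `n` and minimum
Hamming distance `δ`: its minimum distance is exactly `δ` and it meets the Singleton
bound, `|C| = d ^ (n - δ + 1)`. -/
def IsMDSCode (d n δ : ℕ) (C : Finset (Fin n → Fin d)) : Prop :=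
  C.card = d ^ (n - δ + 1) ∧
  (∀ w ∈ C, ∀ w' ∈ C, w ≠ w' → δ ≤ hammingDist w w') ∧
  (∃ w ∈ C, ∃ w' ∈ C, w ≠ w' ∧ hammingDist w w' = δ)

/-- A latin `k`-hypercube of order `d`: fixing all indices but any one of them, the
resulting map `Fin d → Fin d` is a bijection. -/
def IsLatinHypercube (k d : ℕ) (L : (Fin k → Fin d) → Fin d) : Prop :=
  ∀ (i : Fin k) (x : Fin k → Fin d),
    Function.Bijective fun v : Fin d => L (Function.update x i v)

/-- Two latin `k`-hypercubes are orthogonal if for every pair of distinct indices and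
all ways of fixing the remaining indices, the two resulting latin squares are
orthogonal. -/
def AreOrthogonalHypercubes (k d : ℕ) (L M : (Fin k → Fin d) → Fin d) : Prop :=
  ∀ (i j : Fin k), i ≠ j → ∀ x : Fin k → Fin d,
    Function.Injective fun p : Fin d × Fin d =>
      (L (Function.update (Function.update x i p.1) j p.2),
       M (Function.update (Function.update x i p.1) j p.2))

/-- A latin square of order `d`: every row and every column is a bijection. -/
def IsLatinSquare (d : ℕ) (L : Fin d × Fin d → Fin d) : Prop :=
  (∀ i : Fin d, Function.Bijective fun j => L (i, j)) ∧
  (∀ j : Fin d, Function.Bijective fun i => L (i, j))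

/-- Bitmask recording which pairs of labels are used by the block `(r,c,s,t)`. -/
def tmask (r c s t : Fin 6) : ℕ :=
  Nat.lor (1 <<< (6 * r.val + s.val)) (Nat.lor (1 <<< (36 + (6 * c.val + s.val)))
    (Nat.lor (1 <<< (72 + (6 * r.val + t.val))) (Nat.lor (1 <<< (108 + (6 * c.val + t.val)))
      (1 <<< (144 + (6 * s.val + t.val))))))

/-- Backtracking search. -/
def tgo : List (Fin 6 × Fin 6 × List (Fin 6 × Fin 6)) → ℕ → Bool
  | [], _ => true
  | (r, c, cs) :: rest, u => cs.any fun p =>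
      Nat.beq (Nat.land u (tmask r c p.1 p.2)) 0 && tgo rest (Nat.lor u (tmask r c p.1 p.2))

def tA : List (Fin 6 × Fin 6) :=
  [(0,0),(0,1),(1,0),(1,1),(2,2),(2,3),(2,4),(2,5),(3,2),(3,3),(3,4),(3,5),
   (4,2),(4,3),(4,4),(4,5),(5,2),(5,3),(5,4),(5,5)]
def tB : List (Fin 6 × Fin 6) :=
  [(0,2),(0,3),(0,4),(0,5),(1,2),(1,3),(1,4),(1,5),(2,0),(3,0),(4,0),(5,0),
   (2,1),(3,1),(4,1),(5,1)]

def tcells : List (Fin 6 × Fin 6 × List (Fin 6 × Fin 6)) :=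
  [(0,0,[(2,2)]),(0,1,[(3,3)]),(1,0,[(4,4)]),(1,1,[(5,5)]),
   (2,2,[(0,0)]),(3,3,[(0,1)]),(4,4,[(1,0)]),(5,5,[(1,1)]),
   (0,2,tB),(0,3,tB),(0,4,tB),(0,5,tB),(1,2,tB),(1,3,tB),(1,4,tB),(1,5,tB),
   (2,0,tB),(3,0,tB),(4,0,tB),(5,0,tB),(2,1,tB),(3,1,tB),(4,1,tB),(5,1,tB),
   (2,3,tA),(2,4,tA),(2,5,tA),(3,2,tA),(3,4,tA),(3,5,tA),
   (4,2,tA),(4,3,tA),(4,5,tA),(5,2,tA),(5,3,tA),(5,4,tA)]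

set_option maxRecDepth 100000 in
theorem tgo_false : tgo tcells 0 = false := by
  decide +kernel

theorem tgo_sound (l m : Fin 6 → Fin 6 → Fin 6) :
    ∀ (cells : List (Fin 6 × Fin 6 × List (Fin 6 × Fin 6))) (u : ℕ),
      cells.Pairwise (fun x y => (tmask x.1 x.2.1 (l x.1 x.2.1) (m x.1 x.2.1)) &&&
        (tmask y.1 y.2.1 (l y.1 y.2.1) (m y.1 y.2.1)) = 0) →
      (∀ x ∈ cells, u &&& (tmask x.1 x.2.1 (l x.1 x.2.1) (m x.1 x.2.1)) = 0) →
      (∀ x ∈ cells, (l x.1 x.2.1, m x.1 x.2.1) ∈ x.2.2) → tgo cells u = true := by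
  intro cells
  induction cells with
  | nil => intros; rfl
  | cons x rest ih =>
    obtain ⟨r, c, cs⟩ := x
    intro u hp hu hc
    rw [List.pairwise_cons] at hp
    simp only [tgo, List.any_eq_true, Bool.and_eq_true]
    refine ⟨(l r c, m r c), hc _ List.mem_cons_self, ?_, ?_⟩
    · have := hu _ List.mem_cons_self
      simp only at this
      change Nat.beq (u &&& _) 0 = true
      rw [this]
      rfl
    · apply ih _ hp.2
      · intro y hy
        have h1 := hp.1 y hy
        have h2 := hu y (List.mem_cons_of_mem _ hy)
        change (u ||| _) &&& _ = 0
        rw [Nat.and_or_distrib_right, h2, h1]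
        rfl
      · intro y hy
        exact hc y (List.mem_cons_of_mem _ hy)

theorem tmask_disj {r c s t r' c' s' t' : Fin 6} (h1 : ¬ (r = r' ∧ s = s')) (h2 : ¬ (c = c' ∧ s = s'))
    (h3 : ¬ (r = r' ∧ t = t')) (h4 : ¬ (c = c' ∧ t = t')) (h5 : ¬ (s = s' ∧ t = t')) :
    tmask r c s t &&& tmask r' c' s' t' = 0 := by
  apply Nat.eq_of_testBit_eq
  intro i
  have e : ∀ a b : ℕ, Nat.lor a b = a ||| b := fun _ _ => rfl
  simp only [tmask, e, Nat.one_shiftLeft, Nat.testBit_and, Nat.testBit_or, Nat.testBit_two_pow,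
    Nat.zero_testBit]
  rw [Bool.eq_false_iff]
  simp only [ne_eq, Bool.and_eq_true, Bool.or_eq_true, decide_eq_true_eq]
  simp only [Fin.ext_iff] at *
  rintro ⟨ha, hb⟩
  omega

theorem tarry_normal (l m : Fin 6 → Fin 6 → Fin 6)
    (hl1 : ∀ r c c', l r c = l r c' → c = c') (hl2 : ∀ r r' c, l r c = l r' c → r = r')
    (hm1 : ∀ r c c', m r c = m r c' → c = c') (hm2 : ∀ r r' c, m r c = m r' c → r = r')
    (ho : ∀ r c r' c', l r c = l r' c' → m r c = m r' c' → r = r' ∧ c = c')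
    (hA : ∀ r c, (2 ≤ r ∧ 2 ≤ c) → (l r c, m r c) ∈ tA)
    (hB : ∀ r c, ¬ (2 ≤ r ↔ 2 ≤ c) → (l r c, m r c) ∈ tB)
    (h1 : l 0 0 = 2 ∧ m 0 0 = 2) (h2 : l 0 1 = 3 ∧ m 0 1 = 3)
    (h3 : l 1 0 = 4 ∧ m 1 0 = 4) (h4 : l 1 1 = 5 ∧ m 1 1 = 5)
    (h5 : l 2 2 = 0 ∧ m 2 2 = 0) (h6 : l 3 3 = 0 ∧ m 3 3 = 1)
    (h7 : l 4 4 = 1 ∧ m 4 4 = 0) (h8 : l 5 5 = 1 ∧ m 5 5 = 1) : False := by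
  have key := tgo_sound l m tcells 0 ?_ ?_ ?_
  · rw [tgo_false] at key; exact Bool.noConfusion key
  · have hd : tcells.Pairwise (fun x y => ¬ (x.1 = y.1 ∧ x.2.1 = y.2.1)) := by decide +kernel
    refine hd.imp (fun {x y} h => ?_)
    obtain ⟨r, c, w⟩ := x
    obtain ⟨r', c', w'⟩ := y
    simp only at h ⊢
    apply tmask_disj
    · rintro ⟨rfl, hs⟩; exact h ⟨rfl, hl1 _ _ _ hs⟩
    · rintro ⟨rfl, hs⟩; exact h ⟨hl2 _ _ _ hs, rfl⟩
    · rintro ⟨rfl, hs⟩; exact h ⟨rfl, hm1 _ _ _ hs⟩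
    · rintro ⟨rfl, hs⟩; exact h ⟨hm2 _ _ _ hs, rfl⟩
    · rintro ⟨hs, ht⟩; exact h (ho _ _ _ _ hs ht)
  · intro x _; exact Nat.zero_and _
  · simp only [tcells, List.forall_mem_cons, List.mem_singleton, h1, h2, h3, h4, h5, h6, h7, h8,
      true_and]
    refine ⟨?_, ?_, ?_, ?_, ?_, ?_, ?_, ?_, ?_, ?_, ?_, ?_, ?_, ?_, ?_, ?_, ?_, ?_, ?_, ?_,
      ?_, ?_, ?_, ?_, ?_, ?_, ?_, ?_⟩
    all_goals first | (apply hA; decide) | (apply hB; decide) | (simp; apply hA; decide)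

/-- Orthogonal array property. -/
def TOA (f : Fin 4 → Fin 6 × Fin 6 → Fin 6) : Prop :=
  ∀ i j, i ≠ j → Function.Bijective (fun b => (f i b, f j b))

theorem TOA.sum {f} (hf : TOA f) {A : Type*} [AddCommMonoid A] {i j : Fin 4} (h : i ≠ j)
    (g : Fin 6 → Fin 6 → A) : ∑ b, g (f i b) (f j b) = ∑ x, ∑ y, g x y := by
  rw [← Fintype.sum_prod_type' g]
  exact (hf i j h).sum_comp (fun p => g p.1 p.2)

theorem TOA.sum_fix {f} (hf : TOA f) {A : Type*} [AddCommMonoid A] {i j : Fin 4} (h : i ≠ j)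
    (x : Fin 6) (g : Fin 6 → A) : ∑ b, (if f i b = x then g (f j b) else 0) = ∑ y, g y := by
  rw [hf.sum h (fun a c => if a = x then g c else 0)]
  rw [Finset.sum_eq_single x]
  · simp
  · intro b _ hb; simp [hb]
  · simp

theorem TOA.sum_one {f} (hf : TOA f) {A : Type*} [AddCommMonoid A] {i j : Fin 4} (h : j ≠ i)
    (g : Fin 6 → A) : ∑ b, g (f i b) = 6 • ∑ y, g y := by
  rw [hf.sum h (fun _ c => g c)]
  simp

/-- incidence matrix -/
def tN (f : Fin 4 → Fin 6 × Fin 6 → Fin 6) : Matrix (Fin 4 × Fin 6) (Fin 6 × Fin 6) (ZMod 2) :=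
  fun p b => if f p.1 b = p.2 then 1 else 0

/-- left factor of the Gram matrix -/
def tU : Matrix (Fin 4 × Fin 6) (Fin 4) (ZMod 2) := fun p k => if p.1 = k then 0 else 1

/-- right factor of the Gram matrix -/
def tV : Matrix (Fin 4) (Fin 4 × Fin 6) (ZMod 2) := fun k p => if p.1 = k then 1 else 0

theorem tN_gram {f} (hf : TOA f) : tN f * (tN f).transpose =
    tU *
    tV := by
  ext ⟨i, x⟩ ⟨j, y⟩
  simp only [Matrix.mul_apply, Matrix.transpose_apply, tN, tU, tV]
  have e2 : ∑ k : Fin 4, (if i = k then (0 : ZMod 2) else 1) * (if j = k then 1 else 0)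
      = if i = j then 0 else 1 := by
    simp
  rw [e2]
  by_cases hij : i = j
  · subst hij
    obtain ⟨k, hk⟩ : ∃ k, k ≠ i := exists_ne i
    rw [hf.sum_one hk (fun z => (if z = x then (1 : ZMod 2) else 0) * (if z = y then 1 else 0))]
    rw [if_pos rfl, nsmul_eq_mul]
    have : ((6 : ℕ) : ZMod 2) = 0 := by decide
    rw [this, zero_mul]
  · rw [hf.sum hij (fun a c => (if a = x then (1 : ZMod 2) else 0) * (if c = y then 1 else 0))]
    simp [hij]

theorem t_sylvester {K : Type*} [Field K] {m n : Type*} [Fintype m] [Fintype n]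
    (A : Matrix m n K) : 2 * A.rank ≤ (A * A.transpose).rank + Fintype.card n := by
  have h1 := LinearMap.finrank_range_add_finrank_ker A.mulVecLin
  have h2 := LinearMap.finrank_range_add_finrank_ker
    (A.mulVecLin.domRestrict (LinearMap.range A.transpose.mulVecLin))
  have h3 : LinearMap.range (A.mulVecLin.domRestrict (LinearMap.range A.transpose.mulVecLin))
      = LinearMap.range (A * A.transpose).mulVecLin := by
    rw [Matrix.mulVecLin_mul, LinearMap.range_comp, LinearMap.range_domRestrict]
  have h4 : Module.finrank K (LinearMap.ker (A.mulVecLin.domRestrict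
      (LinearMap.range A.transpose.mulVecLin))) ≤ Module.finrank K (LinearMap.ker A.mulVecLin) := by
    refine LinearMap.finrank_le_finrank_of_injective
      (f := ((LinearMap.range A.transpose.mulVecLin).subtype.restrict (p := LinearMap.ker
        (A.mulVecLin.domRestrict (LinearMap.range A.transpose.mulVecLin)))
        (q := LinearMap.ker A.mulVecLin) ?_)) ?_
    · intro x hx
      simpa using hx
    · intro x y hxy
      apply Subtype.ext
      apply Subtype.ext
      exact congrArg (fun z => z.val) hxy
  have h5 : Module.finrank K (LinearMap.range A.transpose.mulVecLin) = A.rank := by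
    rw [← Matrix.rank_transpose A]; rfl
  have h6 : Module.finrank K (LinearMap.range (A * A.transpose).mulVecLin)
    = (A * A.transpose).rank := rfl
  have h7 : Module.finrank K (LinearMap.range A.mulVecLin) = A.rank := rfl
  rw [h3, h5, h6] at h2
  rw [h7, Module.finrank_fintype_fun_eq_card] at h1
  omega

/-- sign of an element of `ZMod 2` -/
def tsgn (a : ZMod 2) : ℤ := 1 - 2 * (a.val : ℤ)

theorem t_exists_relation {f} (hf : TOA f) : ∃ v : Fin 4 × Fin 6 → ZMod 2,
    (∀ b, ∑ i, v (i, f i b) = 0) ∧ ∃ i x y, v (i, x) ≠ v (i, y) := by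
  by_contra! hcon
  have hr : (tN f).rank ≤ 20 := by
    have h := t_sylvester (tN f)
    rw [tN_gram hf] at h
    have h' := Matrix.rank_mul_le_left
      tU
      tV
    have h'' := Matrix.rank_le_card_width
      tU
    simp only [Fintype.card_prod, Fintype.card_fin] at h h''
    omega
  have hk := LinearMap.finrank_range_add_finrank_ker (tN f).transpose.mulVecLin
  have hr' : Module.finrank (ZMod 2) (LinearMap.range (tN f).transpose.mulVecLin) = (tN f).rank := by
    rw [← Matrix.rank_transpose (tN f)]; rfl
  rw [hr', Module.finrank_fintype_fun_eq_card] at hk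
  simp only [Fintype.card_prod, Fintype.card_fin] at hk
  let T : Matrix (Fin 4 × Fin 6) (Fin 3) (ZMod 2) := fun p =>
    ![![1,0,0], ![0,1,0], ![0,0,1], ![1,1,1]] p.1
  have hT := Matrix.rank_le_card_width T
  have hle : LinearMap.ker (tN f).transpose.mulVecLin ≤ LinearMap.range T.mulVecLin := by
    intro v hv
    have hv' : ∀ b, ∑ i, v (i, f i b) = 0 := by
      intro b
      have := congrFun (LinearMap.mem_ker.mp hv) b
      simp only [Matrix.mulVecLin_apply, Matrix.mulVec, dotProduct, Matrix.transpose_apply, tN,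
        Fintype.sum_prod_type, Pi.zero_apply] at this
      simpa using this
    have hc := hcon v hv'
    refine ⟨![v (0,0), v (1,0), v (2,0)], ?_⟩
    ext ⟨i, x⟩
    rw [hc i x 0]
    have h0 := hv' 0
    simp only [Fin.sum_univ_four] at h0
    rw [hc 0 _ 0, hc 1 _ 0, hc 2 _ 0, hc 3 _ 0] at h0
    have key : ∀ a b c d : ZMod 2, a + b + c + d = 0 → a + b + c = d := by decide
    have h3 := key _ _ _ _ h0
    rw [Matrix.mulVecLin_apply]
    simp only [Matrix.mulVec, dotProduct, Fin.sum_univ_three, T]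
    fin_cases i
    · simp
    · simp
    · simp
    · simpa using h3
  have hfin := Submodule.finrank_mono hle
  have : Module.finrank (ZMod 2) (LinearMap.range T.mulVecLin) = T.rank := rfl
  simp only [Fintype.card_fin] at hT
  omega

theorem tprod {A : Type*} [CommMonoid A] {i j k l : Fin 4} (hij : i ≠ j) (hik : i ≠ k) (hil : i ≠ l)
    (hjk : j ≠ k) (hjl : j ≠ l) (hkl : k ≠ l) (g : Fin 4 → A) : ∏ a, g a = g i * g j * g k * g l := by
  have : (Finset.univ : Finset (Fin 4)) = {i, j, k, l} := by
    revert i j k l; decide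
  rw [this, Finset.prod_insert (by simp [*]), Finset.prod_insert (by simp [*]),
    Finset.prod_insert (by simp [*]), Finset.prod_singleton]
  simp only [mul_assoc]

/-- A family of sign functions whose product is one on each block. -/
structure TSigns (f : Fin 4 → Fin 6 × Fin 6 → Fin 6) (χ : Fin 4 → Fin 6 → ℤ) : Prop where
  pm : ∀ i x, χ i x = 1 ∨ χ i x = -1
  prod : ∀ b, ∏ i, χ i (f i b) = 1

theorem TSigns.pair {f χ} (hf : TOA f) (h : TSigns f χ) {i j k l : Fin 4}
    (hij : i ≠ j) (hik : i ≠ k) (hil : i ≠ l)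
    (hjk : j ≠ k) (hjl : j ≠ l) (hkl : k ≠ l) :
    (∑ x, χ i x) * (∑ x, χ j x) = (∑ x, χ k x) * (∑ x, χ l x) := by
  rw [Finset.sum_mul_sum, Finset.sum_mul_sum, ← hf.sum hij (fun x y => χ i x * χ j y),
    ← hf.sum hkl (fun x y => χ k x * χ l y)]
  refine Finset.sum_congr rfl fun b _ => ?_
  have := h.prod b
  rw [tprod hij hik hil hjk hjl hkl] at this
  rcases h.pm i (f i b) with h1 | h1 <;> rcases h.pm j (f j b) with h2 | h2 <;>
  rcases h.pm k (f k b) with h3 | h3 <;> rcases h.pm l (f l b) with h4 | h4 <;>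
  simp_all

theorem TSigns.parity {f χ} (hf : TOA f) (h : TSigns f χ) {i j k l : Fin 4}
    (hij : i ≠ j) (hik : i ≠ k) (hil : i ≠ l)
    (hjk : j ≠ k) (hjl : j ≠ l) (hkl : k ≠ l) :
    (∑ x, χ j x + ∑ x, χ k x + ∑ x, χ l x) % 4 = 2 := by
  have e : ∑ b, (if f i b = 0 then χ j (f j b) + χ k (f k b) + χ l (f l b) + χ i 0 else 0)
      = ∑ x, χ j x + ∑ x, χ k x + ∑ x, χ l x + 6 * χ i 0 := by
    rw [← hf.sum_fix hij 0 (χ j), ← hf.sum_fix hik 0 (χ k), ← hf.sum_fix hil 0 (χ l)]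
    have : 6 * χ i 0 = ∑ b, (if f i b = 0 then χ i 0 else 0) := by
      rw [hf.sum_fix hij 0 (fun _ => χ i 0)]; simp
    rw [this, ← Finset.sum_add_distrib, ← Finset.sum_add_distrib, ← Finset.sum_add_distrib]
    refine Finset.sum_congr rfl fun b _ => ?_
    split_ifs <;> simp
  have d : (4 : ℤ) ∣ ∑ b, (if f i b = 0 then χ j (f j b) + χ k (f k b) + χ l (f l b) + χ i 0 else 0) := by
    refine Finset.dvd_sum fun b _ => ?_
    split_ifs with hb
    · have := h.prod b
      rw [tprod hij hik hil hjk hjl hkl, hb] at this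
      rcases h.pm i 0 with h1 | h1 <;> rcases h.pm j (f j b) with h2 | h2 <;>
      rcases h.pm k (f k b) with h3 | h3 <;> rcases h.pm l (f l b) with h4 | h4 <;>
      simp [h1, h2, h3, h4] at this ⊢
    · exact dvd_zero _
  rw [e] at d
  rcases h.pm i 0 with h1 | h1 <;> rw [h1] at d <;> omega

theorem t_exists_signs {f} (hf : TOA f) : ∃ χ, TSigns f χ ∧ ∀ i, ∑ x, χ i x = 2 := by
  obtain ⟨v, hv, i0, x0, y0, hne⟩ := t_exists_relation hf
  let χ : Fin 4 → Fin 6 → ℤ := fun i x => tsgn (v (i, x))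
  have hχ : TSigns f χ := by
    constructor
    · intro i x
      have key : ∀ a : ZMod 2, tsgn a = 1 ∨ tsgn a = -1 := by decide
      exact key _
    · intro b
      have h0 := hv b
      have key : ∀ a b c d : ZMod 2, a + b + c + d = 0 → tsgn a * tsgn b * tsgn c * tsgn d = 1 := by decide
      rw [Fin.sum_univ_four] at h0
      rw [Fin.prod_univ_four]
      exact key _ _ _ _ h0
  have hb : ∀ i, -6 ≤ ∑ x, χ i x ∧ ∑ x, χ i x ≤ 6 := by
    intro i
    rw [Fin.sum_univ_six]
    have := hχ.pm i
    have a0 := this 0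
    have a1 := this 1
    have a2 := this 2
    have a3 := this 3
    have a4 := this 4
    have a5 := this 5
    omega
  have hb0 : ∑ x, χ i0 x ≠ 6 ∧ ∑ x, χ i0 x ≠ -6 := by
    have hne' : χ i0 x0 ≠ χ i0 y0 := by
      have key : ∀ a b : ZMod 2, a ≠ b → tsgn a ≠ tsgn b := by decide
      exact key _ _ hne
    have := hχ.pm i0
    have a0 := this 0
    have a1 := this 1
    have a2 := this 2
    have a3 := this 3
    have a4 := this 4
    have a5 := this 5
    rw [Fin.sum_univ_six]
    constructor
    · intro h6
      have : ∀ x, χ i0 x = 1 := by intro x; fin_cases x <;> simp only [Fin.reduceFinMk, Fin.zero_eta, Fin.mk_one, Fin.isValue] <;> omega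
      exact hne' (by rw [this, this])
    · intro h6
      have : ∀ x, χ i0 x = -1 := by intro x; fin_cases x <;> simp only [Fin.reduceFinMk, Fin.zero_eta, Fin.mk_one, Fin.isValue] <;> omega
      exact hne' (by rw [this, this])
  have p0 := hχ.parity hf (i := 0) (j := 1) (k := 2) (l := 3) (by decide) (by decide) (by decide) (by decide) (by decide) (by decide)
  have p1 := hχ.parity hf (i := 1) (j := 0) (k := 2) (l := 3) (by decide) (by decide) (by decide) (by decide) (by decide) (by decide)
  have p2 := hχ.parity hf (i := 2) (j := 0) (k := 1) (l := 3) (by decide) (by decide) (by decide) (by decide) (by decide) (by decide)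
  have p3 := hχ.parity hf (i := 3) (j := 0) (k := 1) (l := 2) (by decide) (by decide) (by decide) (by decide) (by decide) (by decide)
  have q1 := hχ.pair hf (i := 0) (j := 1) (k := 2) (l := 3) (by decide) (by decide) (by decide) (by decide) (by decide) (by decide)
  have q2 := hχ.pair hf (i := 0) (j := 2) (k := 1) (l := 3) (by decide) (by decide) (by decide) (by decide) (by decide) (by decide)
  have q3 := hχ.pair hf (i := 0) (j := 3) (k := 1) (l := 2) (by decide) (by decide) (by decide) (by decide) (by decide) (by decide)
  obtain ⟨u, hu⟩ : ∃ u : Fin 4 → ℤ, u = fun i => ∑ x, χ i x := ⟨_, rfl⟩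
  have hu' : ∀ i, ∑ x, χ i x = u i := fun i => by rw [hu]
  simp only [hu'] at hb hb0 p0 p1 p2 p3 q1 q2 q3
  have hs : ∀ i, u i = 2 ∨ u i = -2 ∨ u i = 6 ∨ u i = -6 := by
    have b0 := hb 0
    have b1 := hb 1
    have b2 := hb 2
    have b3 := hb 3
    intro i
    fin_cases i <;> simp only [Fin.reduceFinMk, Fin.zero_eta, Fin.mk_one, Fin.isValue] <;> omega
  have hfin : (∀ i, u i = 2 ∨ u i = -2) ∧ u 0 * u 1 * u 2 * u 3 = 16 := by
    have hi : u i0 = 2 ∨ u i0 = -2 := by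
      have := hs i0; omega
    have hex : (u 0 = 2 ∨ u 0 = -2) ∨ (u 1 = 2 ∨ u 1 = -2) ∨ (u 2 = 2 ∨ u 2 = -2) ∨ (u 3 = 2 ∨ u 3 = -2) := by
      fin_cases i0 <;> simp_all
    have hall : ((u 0 = 2 ∨ u 0 = -2) ∧ (u 1 = 2 ∨ u 1 = -2) ∧ (u 2 = 2 ∨ u 2 = -2) ∧ (u 3 = 2 ∨ u 3 = -2)) ∧ u 0 * u 1 * u 2 * u 3 = 16 := by
      have s0 := hs 0
      have s1 := hs 1
      have s2 := hs 2
      have s3 := hs 3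
      clear hs hi hb0 hb p0 p1 p2 p3 hu' hu
      generalize u 0 = a at *
      generalize u 1 = b at *
      generalize u 2 = c at *
      generalize u 3 = d at *
      rcases s0 with rfl | rfl | rfl | rfl <;> rcases s1 with rfl | rfl | rfl | rfl <;>
      rcases s2 with rfl | rfl | rfl | rfl <;> rcases s3 with rfl | rfl | rfl | rfl <;>
      first | (exfalso; omega) | omega
    refine ⟨?_, hall.2⟩
    intro i
    fin_cases i
    · exact hall.1.1
    · exact hall.1.2.1
    · exact hall.1.2.2.1
    · exact hall.1.2.2.2
  obtain ⟨hu2, hprod⟩ := hfin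
  refine ⟨fun i x => (u i / 2) * χ i x, ⟨?_, ?_⟩, ?_⟩
  · intro i x
    rcases hu2 i with h | h <;> rcases hχ.pm i x with h' | h' <;> simp [h, h']
  · intro b
    rw [Finset.prod_mul_distrib, hχ.prod b, Fin.prod_univ_four]
    rcases hu2 0 with h0 | h0 <;> rcases hu2 1 with h1 | h1 <;> rcases hu2 2 with h2 | h2 <;>
    rcases hu2 3 with h3 | h3 <;> simp [h0, h1, h2, h3] at hprod ⊢
  · intro i
    rw [← Finset.mul_sum, hu']
    rcases hu2 i with h | h <;> simp [h]

theorem TSigns.noThree {f χ} (hf : TOA f) (h : TSigns f χ) (h2 : ∀ i, ∑ x, χ i x = 2)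
    {i j k l : Fin 4} (hij : i ≠ j) (hik : i ≠ k) (hil : i ≠ l)
    (hjk : j ≠ k) (hjl : j ≠ l) (hkl : k ≠ l) (b : Fin 6 × Fin 6)
    (hi : χ i (f i b) = -1) (hj : χ j (f j b) = -1) : χ k (f k b) = 1 := by
  have one : ∀ a c : Fin 4, c ≠ a → ∑ b, χ a (f a b) = 12 := by
    intro a c hac
    rw [hf.sum_one hac (χ a), h2]; rfl
  have two : ∀ a c : Fin 4, a ≠ c → ∑ b, χ a (f a b) * χ c (f c b) = 4 := by
    intro a c hac
    rw [hf.sum hac (fun x y => χ a x * χ c y), ← Finset.sum_mul_sum, h2, h2]; rfl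
  have hs : ∑ b, (1 - χ i (f i b)) * (1 - χ j (f j b)) * (1 - χ k (f k b)) = 0 := by
    have e : ∀ b, (1 - χ i (f i b)) * (1 - χ j (f j b)) * (1 - χ k (f k b)) =
        1 - χ i (f i b) - χ j (f j b) - χ k (f k b) + χ i (f i b) * χ j (f j b)
        + χ i (f i b) * χ k (f k b) + χ j (f j b) * χ k (f k b) - χ l (f l b) := by
      intro b
      have := h.prod b
      rw [tprod hij hik hil hjk hjl hkl] at this
      rcases h.pm i (f i b) with h1 | h1 <;> rcases h.pm j (f j b) with h2 | h2 <;>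
      rcases h.pm k (f k b) with h3 | h3 <;> rcases h.pm l (f l b) with h4 | h4 <;>
      simp [h1, h2, h3, h4] at this ⊢
    simp only [e, Finset.sum_sub_distrib, Finset.sum_add_distrib, one i j hij.symm, one j i hij,
      one k i hik, one l i hil, two i j hij, two i k hik, two j k hjk]
    simp
  have hnn : ∀ b ∈ (Finset.univ : Finset (Fin 6 × Fin 6)),
      0 ≤ (1 - χ i (f i b)) * (1 - χ j (f j b)) * (1 - χ k (f k b)) := by
    intro b _
    rcases h.pm i (f i b) with h1 | h1 <;> rcases h.pm j (f j b) with h2 | h2 <;>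
      rcases h.pm k (f k b) with h3 | h3 <;> simp [h1, h2, h3]
  have := (Finset.sum_eq_zero_iff_of_nonneg hnn).mp hs b (Finset.mem_univ _)
  rw [hi, hj] at this
  omega

theorem TSigns.uniq {f χ} (hf : TOA f) (h : TSigns f χ) (h2 : ∀ i, ∑ x, χ i x = 2)
    {i j k l : Fin 4} (hij : i ≠ j) (hik : i ≠ k) (hil : i ≠ l)
    (hjk : j ≠ k) (hjl : j ≠ l) (hkl : k ≠ l) (b b' : Fin 6 × Fin 6)
    (hi : χ i (f i b) = -1) (hj : χ j (f j b) = -1)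
    (hi' : χ i (f i b') = -1) (hj' : χ j (f j b') = -1) (hk : f k b' = f k b) : b = b' := by
  by_contra hne
  have hz := h.noThree hf h2 hij hik hil hjk hjl hkl b hi hj
  set z := f k b with hzdef
  have hs : ∑ c, (if f k c = z then (1 - χ i (f i c)) * (1 - χ j (f j c)) else 0) = 4 := by
    have e : ∀ c, (if f k c = z then (1 - χ i (f i c)) * (1 - χ j (f j c)) else 0) =
        (if f k c = z then 1 else 0) - (if f k c = z then χ i (f i c) else 0)
        - (if f k c = z then χ j (f j c) else 0) + (if f k c = z then χ l (f l c) else 0) := by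
      intro c
      split_ifs with hc
      · have := h.prod c
        rw [tprod hij hik hil hjk hjl hkl, hc, hz] at this
        rcases h.pm i (f i c) with h1 | h1 <;> rcases h.pm j (f j c) with h2 | h2 <;>
        rcases h.pm l (f l c) with h4 | h4 <;>
        simp [h1, h2, h4] at this ⊢
      · simp
    simp only [e, Finset.sum_sub_distrib, Finset.sum_add_distrib]
    rw [hf.sum_fix hik.symm z (χ i), hf.sum_fix hjk.symm z (χ j), hf.sum_fix hkl z (χ l),
      hf.sum_fix hkl z (fun _ => (1 : ℤ)), h2, h2, h2]
    simp
  have hle : ∑ c ∈ {b, b'}, (if f k c = z then (1 - χ i (f i c)) * (1 - χ j (f j c)) else 0) ≤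
      ∑ c, (if f k c = z then (1 - χ i (f i c)) * (1 - χ j (f j c)) else 0) := by
    apply Finset.sum_le_sum_of_subset_of_nonneg (Finset.subset_univ _)
    intro c _ _
    rcases h.pm i (f i c) with h1 | h1 <;> rcases h.pm j (f j c) with h2 | h2 <;>
      simp [h1, h2] <;> split_ifs <;> simp
  rw [hs, Finset.sum_pair hne, if_pos hk, if_pos hzdef.symm, hi, hj, hi', hj'] at hle
  norm_num at hle

theorem t_two {χ : Fin 6 → ℤ} (pm : ∀ x, χ x = 1 ∨ χ x = -1) (h2 : ∑ x, χ x = 2) :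
    ∃ p q, p ≠ q ∧ χ p = -1 ∧ χ q = -1 := by
  have a0 := pm 0
  have a1 := pm 1
  have a2 := pm 2
  have a3 := pm 3
  have a4 := pm 4
  have a5 := pm 5
  rw [Fin.sum_univ_six] at h2
  by_contra! hc
  have c1 : ∀ p q, p ≠ q → χ p = -1 → χ q = 1 := fun p q hpq hp => by
    have := hc p q hpq hp
    have := pm q
    omega
  have : ∃ p, χ p = -1 := by
    by_contra! hn
    have := hn 0
    have := hn 1
    have := hn 2
    have := hn 3
    have := hn 4
    have := hn 5
    omega
  obtain ⟨p, hp⟩ := this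
  have d := c1 p
  fin_cases p <;> simp [Fin.forall_fin_succ, -forall_eq] at hp d <;> grind

/-- model sign pattern -/
def tpat : Fin 6 → ℤ := ![-1, -1, 1, 1, 1, 1]

/-- A relabelling of one of the groups. -/
theorem TSigns.label {f χ} (hf : TOA f) (h : TSigns f χ) (h2 : ∀ i, ∑ x, χ i x = 2)
    {i j k l : Fin 4} (hij : i ≠ j) (hik : i ≠ k) (hil : i ≠ l)
    (hjk : j ≠ k) (hjl : j ≠ l) (hkl : k ≠ l) (p q pi qi pj qj : Fin 6)
    (hpq : p ≠ q) (hp : χ k p = -1) (hq : χ k q = -1)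
    (hpqi : pi ≠ qi) (hpi : χ i pi = -1) (hqi : χ i qi = -1)
    (hpqj : pj ≠ qj) (hpj : χ j pj = -1) (hqj : χ j qj = -1)
    (b1 b2 b3 b4 : Fin 6 × Fin 6)
    (h1 : f i b1 = pi ∧ f j b1 = pj) (h2' : f i b2 = pi ∧ f j b2 = qj)
    (h3 : f i b3 = qi ∧ f j b3 = pj) (h4 : f i b4 = qi ∧ f j b4 = qj) :
    ∃ E : Fin 6 ≃ Fin 6, (∀ x, χ k (E x) = tpat x) ∧ E 0 = p ∧ E 1 = q ∧ E 2 = f k b1 ∧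
      E 3 = f k b2 ∧ E 4 = f k b3 ∧ E 5 = f k b4 := by
  have o1 := h.noThree hf h2 hij hik hil hjk hjl hkl b1 (by rw [h1.1, hpi]) (by rw [h1.2, hpj])
  have o2 := h.noThree hf h2 hij hik hil hjk hjl hkl b2 (by rw [h2'.1, hpi]) (by rw [h2'.2, hqj])
  have o3 := h.noThree hf h2 hij hik hil hjk hjl hkl b3 (by rw [h3.1, hqi]) (by rw [h3.2, hpj])
  have o4 := h.noThree hf h2 hij hik hil hjk hjl hkl b4 (by rw [h4.1, hqi]) (by rw [h4.2, hqj])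
  have n : ∀ b b' : Fin 6 × Fin 6, (f i b = pi ∨ f i b = qi) → (f j b = pj ∨ f j b = qj) →
      (f i b' = pi ∨ f i b' = qi) → (f j b' = pj ∨ f j b' = qj) →
      (f i b ≠ f i b' ∨ f j b ≠ f j b') → f k b ≠ f k b' := by
    intro b b' q1 q2 q3 q4 q5 q6
    have : b = b' := by
      apply h.uniq hf h2 hij hik hil hjk hjl hkl b b' _ _ _ _ q6.symm
      · rcases q1 with e | e <;> rw [e] <;> assumption
      · rcases q2 with e | e <;> rw [e] <;> assumption
      · rcases q3 with e | e <;> rw [e] <;> assumption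
      · rcases q4 with e | e <;> rw [e] <;> assumption
    subst this
    simp at q5
  have n12 := n b1 b2 (by simp [*]) (by simp [*]) (by simp [*]) (by simp [*]) (by simp [*])
  have n13 := n b1 b3 (by simp [*]) (by simp [*]) (by simp [*]) (by simp [*]) (by simp [*])
  have n14 := n b1 b4 (by simp [*]) (by simp [*]) (by simp [*]) (by simp [*]) (by simp [*])
  have n23 := n b2 b3 (by simp [*]) (by simp [*]) (by simp [*]) (by simp [*]) (by simp [*])
  have n24 := n b2 b4 (by simp [*]) (by simp [*]) (by simp [*]) (by simp [*]) (by simp [*])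
  have n34 := n b3 b4 (by simp [*]) (by simp [*]) (by simp [*]) (by simp [*]) (by simp [*])
  have m : ∀ x y, χ k x = -1 → χ k y = 1 → x ≠ y := by
    rintro x y hx hy rfl
    omega
  let e : Fin 6 → Fin 6 := ![p, q, f k b1, f k b2, f k b3, f k b4]
  have hinj : Function.Injective e := by
    have m1 := m _ _ hp o1
    have m2 := m _ _ hp o2
    have m3 := m _ _ hp o3
    have m4 := m _ _ hp o4
    have m5 := m _ _ hq o1
    have m6 := m _ _ hq o2
    have m7 := m _ _ hq o3
    have m8 := m _ _ hq o4
    have hnd : List.Nodup [p, q, f k b1, f k b2, f k b3, f k b4] := by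
      simp [*]
    have := List.nodup_iff_injective_get.mp hnd
    intro x y hxy
    apply this
    fin_cases x <;> fin_cases y <;> exact hxy
  refine ⟨Equiv.ofBijective e (Finite.injective_iff_bijective.mp hinj), ?_, rfl, rfl, rfl, rfl, rfl, rfl⟩
  intro x
  fin_cases x
  · exact hp
  · exact hq
  · exact o1
  · exact o2
  · exact o3
  · exact o4

theorem tA_mem : ∀ r c s t : Fin 6, tpat r * tpat c * tpat s * tpat t = 1 → (2 ≤ r ∧ 2 ≤ c) →
    (s, t) ∈ tA := by decide +kernel

theorem tB_mem : ∀ r c s t : Fin 6, tpat r * tpat c * tpat s * tpat t = 1 → ¬ (2 ≤ r ↔ 2 ≤ c) →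
    (s, t) ∈ tB := by decide +kernel

theorem TOA.false {f} (hf : TOA f) : False := by
  obtain ⟨χ, h, h2⟩ := t_exists_signs hf
  have hpq := fun i => t_two (h.pm i) (h2 i)
  choose p q hne hp hq using hpq
  have sur : ∀ i j, i ≠ j → ∀ x y, ∃ b, f i b = x ∧ f j b = y := by
    intro i j hij x y
    obtain ⟨b, hb⟩ := (hf i j hij).2 (x, y)
    exact ⟨b, congrArg Prod.fst hb, congrArg Prod.snd hb⟩
  have inj : ∀ i j, i ≠ j → ∀ b b', f i b = f i b' → f j b = f j b' → b = b' := by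
    intro i j hij b b' h1 h2
    exact (hf i j hij).1 (Prod.ext h1 h2)
  obtain ⟨b1, hb1⟩ := sur 0 1 (by decide) (p 0) (p 1)
  obtain ⟨b2, hb2⟩ := sur 0 1 (by decide) (p 0) (q 1)
  obtain ⟨b3, hb3⟩ := sur 0 1 (by decide) (q 0) (p 1)
  obtain ⟨b4, hb4⟩ := sur 0 1 (by decide) (q 0) (q 1)
  obtain ⟨c1, hc1⟩ := sur 2 3 (by decide) (p 2) (p 3)
  obtain ⟨c2, hc2⟩ := sur 2 3 (by decide) (p 2) (q 3)
  obtain ⟨c3, hc3⟩ := sur 2 3 (by decide) (q 2) (p 3)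
  obtain ⟨c4, hc4⟩ := sur 2 3 (by decide) (q 2) (q 3)
  obtain ⟨E0, s0, e00, e01, e02, e03, e04, e05⟩ := h.label hf h2 (i := 2) (j := 3) (k := 0) (l := 1)
    (by decide) (by decide) (by decide) (by decide) (by decide) (by decide) _ _ _ _ _ _
    (hne 0) (hp 0) (hq 0) (hne 2) (hp 2) (hq 2) (hne 3) (hp 3) (hq 3) c1 c2 c3 c4 hc1 hc2 hc3 hc4
  obtain ⟨E1, s1, e10, e11, e12, e13, e14, e15⟩ := h.label hf h2 (i := 2) (j := 3) (k := 1) (l := 0)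
    (by decide) (by decide) (by decide) (by decide) (by decide) (by decide) _ _ _ _ _ _
    (hne 1) (hp 1) (hq 1) (hne 2) (hp 2) (hq 2) (hne 3) (hp 3) (hq 3) c1 c2 c3 c4 hc1 hc2 hc3 hc4
  obtain ⟨E2, s2, e20, e21, e22, e23, e24, e25⟩ := h.label hf h2 (i := 0) (j := 1) (k := 2) (l := 3)
    (by decide) (by decide) (by decide) (by decide) (by decide) (by decide) _ _ _ _ _ _
    (hne 2) (hp 2) (hq 2) (hne 0) (hp 0) (hq 0) (hne 1) (hp 1) (hq 1) b1 b2 b3 b4 hb1 hb2 hb3 hb4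
  obtain ⟨E3, s3, e30, e31, e32, e33, e34, e35⟩ := h.label hf h2 (i := 0) (j := 1) (k := 3) (l := 2)
    (by decide) (by decide) (by decide) (by decide) (by decide) (by decide) _ _ _ _ _ _
    (hne 3) (hp 3) (hq 3) (hne 0) (hp 0) (hq 0) (hne 1) (hp 1) (hq 1) b1 b2 b3 b4 hb1 hb2 hb3 hb4
  have hblk := fun r c => sur 0 1 (by decide) (E0 r) (E1 c)
  choose blk k0 k1 using hblk
  have hfix : ∀ (b : Fin 6 × Fin 6) (r c s t : Fin 6), f 0 b = E0 r → f 1 b = E1 c →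
      f 2 b = E2 s → f 3 b = E3 t →
      E2.symm (f 2 (blk r c)) = s ∧ E3.symm (f 3 (blk r c)) = t := by
    intro b r c s t g0 g1 g2 g3
    have : blk r c = b := inj 0 1 (by decide) _ _ (by rw [k0, g0]) (by rw [k1, g1])
    rw [this, g2, g3]
    simp
  have hprod : ∀ r c, tpat r * tpat c * tpat (E2.symm (f 2 (blk r c))) *
      tpat (E3.symm (f 3 (blk r c))) = 1 := by
    intro r c
    have := h.prod (blk r c)
    rw [Fin.prod_univ_four, k0, k1, s0, s1] at this
    rw [← s2 (E2.symm _), ← s3 (E3.symm _)]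
    simpa using this
  refine tarry_normal (fun r c => E2.symm (f 2 (blk r c))) (fun r c => E3.symm (f 3 (blk r c)))
    ?_ ?_ ?_ ?_ ?_ ?_ ?_
    (hfix b1 _ _ _ _ (by rw [hb1.1, e00]) (by rw [hb1.2, e10]) e22.symm e32.symm)
    (hfix b2 _ _ _ _ (by rw [hb2.1, e00]) (by rw [hb2.2, e11]) e23.symm e33.symm)
    (hfix b3 _ _ _ _ (by rw [hb3.1, e01]) (by rw [hb3.2, e10]) e24.symm e34.symm)
    (hfix b4 _ _ _ _ (by rw [hb4.1, e01]) (by rw [hb4.2, e11]) e25.symm e35.symm)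
    (hfix c1 _ _ _ _ e02.symm e12.symm (by rw [hc1.1, e20]) (by rw [hc1.2, e30]))
    (hfix c2 _ _ _ _ e03.symm e13.symm (by rw [hc2.1, e20]) (by rw [hc2.2, e31]))
    (hfix c3 _ _ _ _ e04.symm e14.symm (by rw [hc3.1, e21]) (by rw [hc3.2, e30]))
    (hfix c4 _ _ _ _ e05.symm e15.symm (by rw [hc4.1, e21]) (by rw [hc4.2, e31]))
  · intro r c c' hh
    have hb := inj 0 2 (by decide) (blk r c) (blk r c') (by rw [k0, k0]) (E2.symm.injective hh)
    apply E1.injective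
    rw [← k1 r c, ← k1 r c', hb]
  · intro r r' c hh
    have hb := inj 1 2 (by decide) (blk r c) (blk r' c) (by rw [k1, k1]) (E2.symm.injective hh)
    apply E0.injective
    rw [← k0 r c, ← k0 r' c, hb]
  · intro r c c' hh
    have hb := inj 0 3 (by decide) (blk r c) (blk r c') (by rw [k0, k0]) (E3.symm.injective hh)
    apply E1.injective
    rw [← k1 r c, ← k1 r c', hb]
  · intro r r' c hh
    have hb := inj 1 3 (by decide) (blk r c) (blk r' c) (by rw [k1, k1]) (E3.symm.injective hh)
    apply E0.injective
    rw [← k0 r c, ← k0 r' c, hb]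
  · intro r c r' c' hh hh'
    have hb := inj 2 3 (by decide) (blk r c) (blk r' c') (E2.symm.injective hh)
      (E3.symm.injective hh')
    constructor
    · apply E0.injective
      rw [← k0 r c, ← k0 r' c', hb]
    · apply E1.injective
      rw [← k1 r c, ← k1 r' c', hb]
  · intro r c hrc
    exact tA_mem r c _ _ (hprod r c) hrc
  · intro r c hrc
    exact tB_mem r c _ _ (hprod r c) hrc

/-- Tarry's theorem: there is no pair of orthogonal latin squares of order 6. -/
theorem no_orthogonal_latin_squares_order_six :
    ¬ ∃ L M : Fin 6 × Fin 6 → Fin 6,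
        IsLatinSquare 6 L ∧ IsLatinSquare 6 M ∧
        Function.Injective fun p : Fin 6 × Fin 6 => (L p, M p) := by
  rintro ⟨L, M, ⟨hL1, hL2⟩, ⟨hM1, hM2⟩, hO⟩
  let f : Fin 4 → Fin 6 × Fin 6 → Fin 6 := ![Prod.fst, Prod.snd, L, M]
  have a01 : ∀ b b' : Fin 6 × Fin 6, b.1 = b'.1 → b.2 = b'.2 → b = b' :=
    fun b b' h1 h2 => Prod.ext h1 h2
  have r1 : ∀ N : Fin 6 × Fin 6 → Fin 6, (∀ i, Function.Bijective fun j => N (i, j)) →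
      ∀ b b' : Fin 6 × Fin 6, b.1 = b'.1 → N b = N b' → b = b' := by
    rintro N hN ⟨r, c⟩ ⟨r', c'⟩ h1 h2
    simp only at h1
    subst h1
    rw [(hN r).1 h2]
  have r2 : ∀ N : Fin 6 × Fin 6 → Fin 6, (∀ j, Function.Bijective fun i => N (i, j)) →
      ∀ b b' : Fin 6 × Fin 6, b.2 = b'.2 → N b = N b' → b = b' := by
    rintro N hN ⟨r, c⟩ ⟨r', c'⟩ h1 h2
    simp only at h1
    subst h1
    rw [(hN c).1 h2]
  have a23 : ∀ b b' : Fin 6 × Fin 6, L b = L b' → M b = M b' → b = b' :=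
    fun b b' h1 h2 => hO (Prod.ext h1 h2)
  have hf : TOA f := by
    intro i j hij
    refine (Fintype.bijective_iff_injective_and_card _).mpr ⟨?_, rfl⟩
    intro b b' hb
    have h1 : f i b = f i b' := congrArg Prod.fst hb
    have h2 : f j b = f j b' := congrArg Prod.snd hb
    clear hb
    fin_cases i <;> fin_cases j
    · exact absurd rfl hij
    · exact a01 b b' h1 h2
    · exact r1 L hL1 b b' h1 h2
    · exact r1 M hM1 b b' h1 h2
    · exact a01 b b' h2 h1
    · exact absurd rfl hij
    · exact r2 L hL2 b b' h1 h2
    · exact r2 M hM2 b b' h1 h2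
    · exact r1 L hL1 b b' h2 h1
    · exact r2 L hL2 b b' h2 h1
    · exact absurd rfl hij
    · exact a23 b b' h1 h2
    · exact r1 M hM1 b b' h2 h1
    · exact r2 M hM2 b b' h2 h1
    · exact a23 b b' h2 h1
    · exact absurd rfl hij
  exact hf.false

end AMEPaper
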